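/- Let Q be a set of n points in general position in the plane consisting of n/2 pairs of 'twins' (each pair extremely close together, obtained by doubling the points of a set with no more than 2 log₂ n points in convex position). If S is a family of convex sets separating Q, then |S| ≥ n/(2 log₂ n). Consequently s'(n, A) ≥ n/(2 log n) for the family A of convex sets. -/

import Mathlib

/-- Points of the plane. -/
abbrev Pt := ℝ × ℝ

/-- A family `F` of planar sets separates a finite point set `P` if for every
pair of distinct points of `P` some member of `F` contains exactly one of them. -/
def SepPts (F : Finset (Set Pt)) (P : Finset Pt) : Prop :=
  ∀ x ∈ P, ∀ y ∈ P, x ≠ y → ∃ S ∈ F, (x ∈ S ↔ y ∉ S)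

/-- A (closed) halfplane. -/
def IsHalfplane (S : Set Pt) : Prop :=
  ∃ u : Pt, ∃ c : ℝ, u ≠ 0 ∧ S = {p : Pt | p.1 * u.1 + p.2 * u.2 ≤ c}

/-- A closed disc of positive radius. -/
def IsClosedDisc (S : Set Pt) : Prop :=
  ∃ q : Pt, ∃ r : ℝ, 0 < r ∧ S = Metric.closedBall q r

/-- A finite point set is in general position if no three of its points are
collinear. -/
def GenPos (P : Finset Pt) : Prop :=
  ∀ a ∈ P, ∀ b ∈ P, ∀ c ∈ P, a ≠ b → a ≠ c → b ≠ c → ¬ Collinear ℝ ({a, b, c} : Set Pt)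

/-- A finite point set is in convex position if each of its points is an
extreme point of the convex hull, i.e. lies outside the hull of the others. -/
def ConvexPos (Q : Finset Pt) : Prop :=
  ∀ q ∈ Q, q ∉ convexHull ℝ (↑(Q.erase q) : Set Pt)

/-- A finite point set lying on a circle. -/
def OnCircle (P : Finset Pt) : Prop :=
  ∃ q : Pt, ∃ r : ℝ, 0 < r ∧ ∀ x ∈ P, dist x q = r


namespace CGP

def dt (p q r : Pt) : ℝ := (q.1 - p.1) * (r.2 - p.2) - (r.1 - p.1) * (q.2 - p.2)

def Cap (C : Finset Pt) : Prop :=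
  ∀ p ∈ C, ∀ q ∈ C, ∀ r ∈ C, p.1 < q.1 → q.1 < r.1 → dt p q r < 0

def Cup (C : Finset Pt) : Prop :=
  ∀ p ∈ C, ∀ q ∈ C, ∀ r ∈ C, p.1 < q.1 → q.1 < r.1 → 0 < dt p q r

structure Good (s t : ℕ) (P : Finset Pt) : Prop where
  inj : ∀ p ∈ P, ∀ q ∈ P, p.1 = q.1 → p = q
  ne : ∀ p ∈ P, ∀ q ∈ P, ∀ r ∈ P, p.1 < q.1 → q.1 < r.1 → dt p q r ≠ 0
  cap : ∀ C ⊆ P, Cap C → C.card ≤ s + 1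
  cup : ∀ C ⊆ P, Cup C → C.card ≤ t + 1

lemma Good.mono {s t : ℕ} {P P' : Finset Pt} (h : Good s t P) (hs : P' ⊆ P) : Good s t P' where
  inj p hp q hq := h.inj p (hs hp) q (hs hq)
  ne p hp q hq r hr := h.ne p (hs hp) q (hs hq) r (hs hr)
  cap C hC := h.cap C (hC.trans hs)
  cup C hC := h.cup C (hC.trans hs)

lemma dt_add (p q r v : Pt) : dt (p + v) (q + v) (r + v) = dt p q r := by
  simp [dt]

lemma Good.translate {s t : ℕ} {P : Finset Pt} (h : Good s t P) (v : Pt) :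
    Good s t (P.image (· + v)) := by
  have key : ∀ C ⊆ P.image (· + v), ∃ D ⊆ P, C = D.image (· + v) := by
    intro C hC
    obtain ⟨D, hD, rfl⟩ := Finset.subset_image_iff.1 hC
    exact ⟨D, by exact_mod_cast hD, rfl⟩
  refine ⟨?_, ?_, ?_, ?_⟩
  · intro p hp q hq hpq
    replace hp := Finset.mem_image.1 hp; obtain ⟨p, hp, rfl⟩ := hp
    replace hq := Finset.mem_image.1 hq; obtain ⟨q, hq, rfl⟩ := hq
    have := h.inj p hp q hq (by simpa using hpq)
    rw [this]
  · intro p hp q hq r hr hpq hqr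
    replace hp := Finset.mem_image.1 hp; obtain ⟨p, hp, rfl⟩ := hp
    replace hq := Finset.mem_image.1 hq; obtain ⟨q, hq, rfl⟩ := hq
    replace hr := Finset.mem_image.1 hr; obtain ⟨r, hr, rfl⟩ := hr
    simp only [dt_add]
    exact h.ne p hp q hq r hr (by simpa using hpq) (by simpa using hqr)
  · intro C hC hcap
    obtain ⟨D, hD, rfl⟩ := key C hC
    refine Finset.card_image_le.trans (h.cap D hD ?_)
    intro p hp q hq r hr hpq hqr
    have := hcap _ (Finset.mem_image_of_mem _ hp) _ (Finset.mem_image_of_mem _ hq) _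
      (Finset.mem_image_of_mem _ hr) (by simpa using hpq) (by simpa using hqr)
    simpa only [dt_add] using this
  · intro C hC hcup
    obtain ⟨D, hD, rfl⟩ := key C hC
    refine Finset.card_image_le.trans (h.cup D hD ?_)
    intro p hp q hq r hr hpq hqr
    have := hcup _ (Finset.mem_image_of_mem _ hp) _ (Finset.mem_image_of_mem _ hq) _
      (Finset.mem_image_of_mem _ hr) (by simpa using hpq) (by simpa using hqr)
    simpa only [dt_add] using this

open Filter in
/-- Far translation. -/
lemma exists_translate (A B : Finset Pt) : ∃ v : Pt,
    (∀ a ∈ A, ∀ b ∈ B, a.1 < (b + v).1) ∧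
    (∀ a ∈ A, ∀ a' ∈ A, ∀ b ∈ B, a.1 < a'.1 → 0 < dt a a' (b + v)) ∧
    (∀ a ∈ A, ∀ b ∈ B, ∀ b' ∈ B, b.1 < b'.1 → dt a (b + v) (b' + v) < 0) := by
  have h1 : ∀ᶠ X : ℝ in atTop, ∀ a ∈ A, ∀ b ∈ B, a.1 < b.1 + X := by
    simp only [Filter.eventually_all_finset]
    intro a _ b _
    filter_upwards [eventually_gt_atTop (a.1 - b.1)] with X hX
    linarith
  obtain ⟨X, hX⟩ := h1.exists
  have h2 : ∀ᶠ Y : ℝ in atTop, ∀ a ∈ A, ∀ a' ∈ A, ∀ b ∈ B, a.1 < a'.1 →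
      0 < dt a a' (b + (X, Y)) := by
    simp only [Filter.eventually_all_finset]
    intro a _ a' _ b _
    by_cases h : a.1 < a'.1
    · have h' : 0 < a'.1 - a.1 := sub_pos.2 h
      filter_upwards [eventually_gt_atTop
        ((b.1 + X - a.1) * (a'.2 - a.2) / (a'.1 - a.1) - b.2 + a.2)] with Y hY _
      simp only [dt, Prod.fst_add, Prod.snd_add]
      have : (b.1 + X - a.1) * (a'.2 - a.2) / (a'.1 - a.1) < b.2 + Y - a.2 := by linarith
      rw [div_lt_iff₀ h'] at this
      linarith
    · simp [h]
  have h3 : ∀ᶠ Y : ℝ in atTop, ∀ a ∈ A, ∀ b ∈ B, ∀ b' ∈ B, b.1 < b'.1 →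
      dt a (b + (X, Y)) (b' + (X, Y)) < 0 := by
    simp only [Filter.eventually_all_finset]
    intro a _ b _ b' _
    by_cases h : b.1 < b'.1
    · have h' : 0 < b'.1 - b.1 := sub_pos.2 h
      filter_upwards [eventually_gt_atTop
        (((b.1 + X - a.1) * (b'.2 - a.2) - (b'.1 + X - a.1) * (b.2 - a.2)) / (b'.1 - b.1))]
        with Y hY _
      simp only [dt, Prod.fst_add, Prod.snd_add]
      rw [div_lt_iff₀ h'] at hY
      linarith
    · simp [h]
  obtain ⟨Y, hY2, hY3⟩ := (h2.and h3).exists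
  exact ⟨(X, Y), hX, hY2, hY3⟩

lemma Good.union {s t : ℕ} {A B : Finset Pt} (hA : Good (s + 1) t A) (hB : Good s (t + 1) B)
    (h1 : ∀ a ∈ A, ∀ b ∈ B, a.1 < b.1)
    (h2 : ∀ a ∈ A, ∀ a' ∈ A, ∀ b ∈ B, a.1 < a'.1 → 0 < dt a a' b)
    (h3 : ∀ a ∈ A, ∀ b ∈ B, ∀ b' ∈ B, b.1 < b'.1 → dt a b b' < 0) :
    Good (s + 1) (t + 1) (A ∪ B) := by
  have split : ∀ C ⊆ A ∪ B, C.card ≤ (C ∩ A).card + (C ∩ B).card := by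
    intro C hC
    calc C.card = ((C ∩ A) ∪ (C ∩ B)).card := by
          rw [← Finset.inter_union_distrib_left, Finset.inter_eq_left.2 hC]
      _ ≤ _ := Finset.card_union_le _ _
  refine ⟨?_, ?_, ?_, ?_⟩
  · intro p hp q hq hpq
    rcases Finset.mem_union.1 hp with hp | hp <;> rcases Finset.mem_union.1 hq with hq | hq
    · exact hA.inj p hp q hq hpq
    · exact absurd hpq (h1 p hp q hq).ne
    · exact absurd hpq (h1 q hq p hp).ne'
    · exact hB.inj p hp q hq hpq
  · intro p hp q hq r hr hpq hqr
    rcases Finset.mem_union.1 hp with hp | hp <;> rcases Finset.mem_union.1 hq with hq | hq <;>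
      rcases Finset.mem_union.1 hr with hr | hr
    · exact hA.ne p hp q hq r hr hpq hqr
    · exact (h2 p hp q hq r hr hpq).ne'
    · exact absurd hqr (h1 r hr q hq).not_gt
    · exact (h3 p hp q hq r hr hqr).ne
    · exact absurd hpq (h1 q hq p hp).not_gt
    · exact absurd hpq (h1 q hq p hp).not_gt
    · exact absurd hqr (h1 r hr q hq).not_gt
    · exact hB.ne p hp q hq r hr hpq hqr
  · intro C hC hcap
    have hs := split C hC
    have hCA := hA.cap (C ∩ A) Finset.inter_subset_right
      (fun p hp q hq r hr => hcap p (Finset.inter_subset_left hp) q (Finset.inter_subset_left hq)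
        r (Finset.inter_subset_left hr))
    have hCB := hB.cap (C ∩ B) Finset.inter_subset_right
      (fun p hp q hq r hr => hcap p (Finset.inter_subset_left hp) q (Finset.inter_subset_left hq)
        r (Finset.inter_subset_left hr))
    rcases (C ∩ B).eq_empty_or_nonempty with he | ⟨b, hb⟩
    · rw [he] at hs
      simp at hs
      omega
    · rw [Finset.mem_inter] at hb
      have : (C ∩ A).card ≤ 1 := by
        rw [Finset.card_le_one]
        intro a ha a' ha'
        rw [Finset.mem_inter] at ha ha'
        apply hA.inj a ha.2 a' ha'.2
        by_contra hne
        rcases lt_or_gt_of_ne hne with hlt | hlt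
        · exact absurd (hcap a ha.1 a' ha'.1 b hb.1 hlt (h1 _ ha'.2 _ hb.2))
            (h2 a ha.2 a' ha'.2 b hb.2 hlt).not_gt
        · exact absurd (hcap a' ha'.1 a ha.1 b hb.1 hlt (h1 _ ha.2 _ hb.2))
            (h2 a' ha'.2 a ha.2 b hb.2 hlt).not_gt
      omega
  · intro C hC hcup
    have hs := split C hC
    have hCA := hA.cup (C ∩ A) Finset.inter_subset_right
      (fun p hp q hq r hr => hcup p (Finset.inter_subset_left hp) q (Finset.inter_subset_left hq)
        r (Finset.inter_subset_left hr))
    have hCB := hB.cup (C ∩ B) Finset.inter_subset_right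
      (fun p hp q hq r hr => hcup p (Finset.inter_subset_left hp) q (Finset.inter_subset_left hq)
        r (Finset.inter_subset_left hr))
    rcases (C ∩ A).eq_empty_or_nonempty with he | ⟨a, ha⟩
    · rw [he] at hs
      simp at hs
      omega
    · rw [Finset.mem_inter] at ha
      have : (C ∩ B).card ≤ 1 := by
        rw [Finset.card_le_one]
        intro b hb b' hb'
        rw [Finset.mem_inter] at hb hb'
        apply hB.inj b hb.2 b' hb'.2
        by_contra hne
        rcases lt_or_gt_of_ne hne with hlt | hlt
        · exact absurd (hcup a ha.1 b hb.1 b' hb'.1 (h1 _ ha.2 _ hb.2) hlt)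
            (h3 a ha.2 b hb.2 b' hb'.2 hlt).not_gt
        · exact absurd (hcup a ha.1 b' hb'.1 b hb.1 (h1 _ ha.2 _ hb'.2) hlt)
            (h3 a ha.2 b' hb'.2 b hb.2 hlt).not_gt
      omega

lemma good_singleton (s t : ℕ) : Good s t {(0 : Pt)} := by
  refine ⟨?_, ?_, ?_, ?_⟩
  · intro p hp q hq _
    rw [Finset.mem_singleton] at hp hq
    rw [hp, hq]
  · intro p hp q hq r hr hpq
    rw [Finset.mem_singleton] at hp hq
    rw [hp, hq] at hpq
    exact absurd hpq (lt_irrefl _)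
  · intro C hC _
    have := Finset.card_le_card hC
    simp at this
    omega
  · intro C hC _
    have := Finset.card_le_card hC
    simp at this
    omega

lemma exists_good (s t : ℕ) : ∃ P : Finset Pt, P.card = (s + t).choose s ∧ Good s t P := by
  induction s generalizing t with
  | zero => exact ⟨{0}, by simp, good_singleton _ _⟩
  | succ s ihs =>
    induction t with
    | zero => exact ⟨{0}, by simp, good_singleton _ _⟩
    | succ t iht =>
      obtain ⟨A, hAc, hA⟩ := iht
      obtain ⟨B, hBc, hB⟩ := ihs (t + 1)
      obtain ⟨v, h1, h2, h3⟩ := exists_translate A B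
      have g := hA.union (hB.translate v) (A := A) (by
          intro a ha b hb
          replace hb := Finset.mem_image.1 hb; obtain ⟨b, hb, rfl⟩ := hb
          exact h1 a ha b hb) (by
          intro a ha a' ha' b hb
          replace hb := Finset.mem_image.1 hb; obtain ⟨b, hb, rfl⟩ := hb
          exact h2 a ha a' ha' b hb) (by
          intro a ha b hb b' hb' hlt
          replace hb := Finset.mem_image.1 hb; obtain ⟨b, hb, rfl⟩ := hb
          replace hb' := Finset.mem_image.1 hb'; obtain ⟨b', hb', rfl⟩ := hb'
          exact h3 a ha b hb b' hb' (by simpa using hlt))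
      refine ⟨_, ?_, g⟩
      rw [Finset.card_union_of_disjoint, Finset.card_image_of_injective _ (add_left_injective v),
        hAc, hBc]
      · have e1 : s + 1 + (t + 1) = (s + t + 1) + 1 := by ring
        have e2 : s + 1 + t = s + t + 1 := by ring
        have e3 : s + (t + 1) = s + t + 1 := by ring
        rw [e1, e2, e3, Nat.choose_succ_succ (s + t + 1) s, add_comm]
      · rw [Finset.disjoint_left]
        intro a ha hb
        replace hb := Finset.mem_image.1 hb; obtain ⟨b, hb, rfl⟩ := hb
        exact lt_irrefl _ (h1 _ ha b hb)

/-- Among more than `s + t` points some point lies strictly above a chord and strictly below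
another chord. -/
lemma Good.exists_inner {s t : ℕ} {T : Finset Pt} (h : Good s t T) (hst : 1 ≤ s + t)
    (hT : s + t < T.card) :
    ∃ l ∈ T, ∃ r ∈ T, ∃ p ∈ T, ∃ p' ∈ T, ∃ q ∈ T, l.1 < q.1 ∧ q.1 < r.1 ∧ p.1 < q.1 ∧ q.1 < p'.1 ∧
      dt l q r < 0 ∧ 0 < dt p q p' := by
  have hne : T.Nonempty := Finset.card_pos.1 (by omega)
  obtain ⟨l, hl, hlm⟩ := T.exists_min_image (fun p => p.1) hne
  obtain ⟨r, hr, hrm⟩ := T.exists_max_image (fun p => p.1) hne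
  have hlr : l ≠ r := by
    intro e
    have : T.card ≤ 1 := by
      rw [Finset.card_le_one]
      intro a ha b hb
      have h1 := hlm a ha
      have h2 := hrm a ha
      have h3 := hlm b hb
      have h4 := hrm b hb
      rw [e] at h1 h3
      exact h.inj a ha b hb (by linarith)
    omega
  have hlt : ∀ q ∈ T, q ≠ l → l.1 < q.1 := fun q hq hql =>
    lt_of_le_of_ne (hlm q hq) (fun e => hql (h.inj l hl q hq e).symm)
  have hgt : ∀ q ∈ T, q ≠ r → q.1 < r.1 := fun q hq hqr =>
    lt_of_le_of_ne (hrm q hq) (fun e => hqr (h.inj q hq r hr e))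
  classical
  let M := (T.erase l).erase r
  let U := M.filter (fun q => dt l q r < 0)
  let D := M.filter (fun q => ¬ dt l q r < 0)
  have hM : M.card = T.card - 2 := by
    have h1 : r ∈ T.erase l := Finset.mem_erase.2 ⟨hlr.symm, hr⟩
    simp only [M]
    rw [Finset.card_erase_of_mem h1, Finset.card_erase_of_mem hl]
    omega
  have hUD : U.card + D.card = M.card := Finset.card_filter_add_card_filter_not _
  have hMm : ∀ q ∈ M, q ∈ T ∧ q ≠ l ∧ q ≠ r := by
    intro q hq
    simp only [M, Finset.mem_erase] at hq
    exact ⟨hq.2.2, hq.2.1, hq.1⟩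
  have cardins : ∀ V ⊆ M, (insert l (insert r V)).card = V.card + 2 := by
    intro V hV
    rw [Finset.card_insert_of_notMem, Finset.card_insert_of_notMem]
    · intro hh
      exact (hMm _ (hV hh)).2.2 rfl
    · intro hh
      rcases Finset.mem_insert.1 hh with e | hh
      · exact hlr e
      · exact (hMm _ (hV hh)).2.1 rfl
  have subins : ∀ V ⊆ M, insert l (insert r V) ⊆ T := by
    intro V hV q hq
    simp only [Finset.mem_insert] at hq
    rcases hq with rfl | rfl | hq
    · exact hl
    · exact hr
    · exact (hMm q (hV hq)).1
  have mid : ∀ V ⊆ M, ∀ p ∈ insert l (insert r V), ∀ q ∈ insert l (insert r V),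
      ∀ p' ∈ insert l (insert r V), p.1 < q.1 → q.1 < p'.1 → q ∈ V := by
    intro V hV p hp q hq p' hp' h1 h2
    rcases Finset.mem_insert.1 hq with e | hq'
    · exact absurd (hlm p (subins V hV hp)) (by rw [← e]; exact h1.not_ge)
    · rcases Finset.mem_insert.1 hq' with e | hq'
      · exact absurd (hrm p' (subins V hV hp')) (by rw [← e]; exact h2.not_ge)
      · exact hq'
  have hUM : U ⊆ M := Finset.filter_subset _ _
  have hDM : D ⊆ M := Finset.filter_subset _ _
  by_contra hcon
  have capU : Cap (insert l (insert r U)) := by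
    intro p hp q hq p' hp' h1 h2
    have hqU := mid U hUM p hp q hq p' hp' h1 h2
    have hqM := hMm q (hUM hqU)
    by_contra hd
    have hne := h.ne p (subins U hUM hp) q hqM.1 p' (subins U hUM hp') h1 h2
    exact hcon ⟨l, hl, r, hr, p, subins U hUM hp, p', subins U hUM hp', q, hqM.1,
      hlt q hqM.1 hqM.2.1, hgt q hqM.1 hqM.2.2, h1, h2, (Finset.mem_filter.1 hqU).2,
      lt_of_le_of_ne (not_lt.1 hd) hne.symm⟩
  have cupD : Cup (insert l (insert r D)) := by
    intro p hp q hq p' hp' h1 h2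
    have hqD := mid D hDM p hp q hq p' hp' h1 h2
    have hqM := hMm q (hDM hqD)
    by_contra hd
    have hne := h.ne p (subins D hDM hp) q hqM.1 p' (subins D hDM hp') h1 h2
    have hne' := h.ne l hl q hqM.1 r hr (hlt q hqM.1 hqM.2.1) (hgt q hqM.1 hqM.2.2)
    exact hcon ⟨p, subins D hDM hp, p', subins D hDM hp', l, hl, r, hr, q, hqM.1, h1, h2,
      hlt q hqM.1 hqM.2.1, hgt q hqM.1 hqM.2.2, lt_of_le_of_ne (not_lt.1 hd) hne,
      lt_of_le_of_ne (not_lt.1 (Finset.mem_filter.1 hqD).2) hne'.symm⟩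
  have c1 := h.cap _ (subins U hUM) capU
  have c2 := h.cup _ (subins D hDM) cupD
  rw [cardins U hUM] at c1
  rw [cardins D hDM] at c2
  omega

/-- A point on a chord of a convex set. -/
lemma chord {A : Set Pt} (hA : Convex ℝ A) {l r : Pt} (hl : l ∈ A) (hr : r ∈ A) {x : ℝ}
    (h1 : l.1 < x) (h2 : x < r.1) :
    ((x, l.2 + (x - l.1) / (r.1 - l.1) * (r.2 - l.2)) : Pt) ∈ A := by
  have hp : 0 < r.1 - l.1 := by linarith
  have := hA.add_smul_sub_mem hl hr (t := (x - l.1) / (r.1 - l.1))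
    ⟨div_nonneg (by linarith) hp.le, by rw [div_le_one hp]; linarith⟩
  convert this using 1
  ext
  · simp
    field_simp
    ring
  · simp

lemma mem_of_chords {A : Set Pt} (hA : Convex ℝ A) {l r p p' q : Pt} (hl : l ∈ A) (hr : r ∈ A)
    (hp : p ∈ A) (hp' : p' ∈ A) (h1 : l.1 < q.1) (h2 : q.1 < r.1) (h3 : p.1 < q.1)
    (h4 : q.1 < p'.1) (h5 : dt l q r < 0) (h6 : 0 < dt p q p') : q ∈ A := by
  have c1 := chord hA hl hr h1 h2
  have c2 := chord hA hp hp' h3 h4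
  set y1 := l.2 + (q.1 - l.1) / (r.1 - l.1) * (r.2 - l.2) with hy1
  set y2 := p.2 + (q.1 - p.1) / (p'.1 - p.1) * (p'.2 - p.2) with hy2
  have e1 : y1 < q.2 := by
    have hh : 0 < r.1 - l.1 := by linarith
    have : (q.1 - l.1) / (r.1 - l.1) * (r.2 - l.2) < q.2 - l.2 := by
      rw [div_mul_eq_mul_div, div_lt_iff₀ hh]
      simp only [dt] at h5
      linarith
    linarith
  have e2 : q.2 < y2 := by
    have hh : 0 < p'.1 - p.1 := by linarith
    have : q.2 - p.2 < (q.1 - p.1) / (p'.1 - p.1) * (p'.2 - p.2) := by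
      rw [div_mul_eq_mul_div, lt_div_iff₀ hh]
      simp only [dt] at h6
      linarith
    linarith
  have hh : 0 < y2 - y1 := by linarith
  have := hA.add_smul_sub_mem c1 c2 (t := (q.2 - y1) / (y2 - y1))
    ⟨div_nonneg (by linarith) hh.le, by rw [div_le_one hh]; linarith⟩
  convert this using 1
  ext
  · simp
  · simp
    field_simp
    ring

end CGP

namespace CGP

open Filter Topology in
lemma ev_quad (A B D : ℝ) (h : B ≠ 0 ∨ D ≠ 0) :
    ∀ᶠ t : ℝ in 𝓝[≠] 0, A + B * t + D * t ^ 2 ≠ 0 := by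
  by_cases hA : A = 0
  · by_cases hB : B = 0
    · have hD : D ≠ 0 := by tauto
      filter_upwards [self_mem_nhdsWithin] with t ht
      have ht : t ≠ 0 := ht
      simp [hA, hB, hD, ht]
    · have h1 : ContinuousAt (fun t : ℝ => B + D * t) 0 := by fun_prop
      have h2 : ∀ᶠ t : ℝ in 𝓝 0, B + D * t ≠ 0 := h1.eventually_ne (by simpa using hB)
      filter_upwards [self_mem_nhdsWithin, h2.filter_mono nhdsWithin_le_nhds] with t ht h3
      have ht : t ≠ 0 := ht
      have : A + B * t + D * t ^ 2 = t * (B + D * t) := by rw [hA]; ring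
      rw [this]
      exact mul_ne_zero ht h3
  · have h1 : ContinuousAt (fun t : ℝ => A + B * t + D * t ^ 2) 0 := by fun_prop
    have h2 : ∀ᶠ t : ℝ in 𝓝 0, A + B * t + D * t ^ 2 ≠ 0 := h1.eventually_ne (by simpa using hA)
    exact h2.filter_mono nhdsWithin_le_nhds

open Filter Topology in
lemma exists_perturb {n : ℕ} (z : Fin n → Pt) : ∃ w : Fin n → Pt, Function.Injective w ∧
    (∀ i j k, i ≠ j → i ≠ k → j ≠ k → dt (w i) (w j) (w k) ≠ 0) ∧
    (∀ i j, (z i).1 < (z j).1 → (w i).1 < (w j).1) ∧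
    (∀ i j k, 0 < dt (z i) (z j) (z k) → 0 < dt (w i) (w j) (w k)) ∧
    (∀ i j k, dt (z i) (z j) (z k) < 0 → dt (w i) (w j) (w k) < 0) := by
  let w : ℝ → Fin n → Pt := fun t i => ((z i).1 + t * (i : ℕ), (z i).2 + t * ((i : ℕ) : ℝ) ^ 2)
  have castne : ∀ i j : Fin n, i ≠ j → ((j : ℕ) : ℝ) - ((i : ℕ) : ℝ) ≠ 0 := by
    intro i j hij
    rw [sub_ne_zero]
    intro e
    exact hij (Fin.ext (by exact_mod_cast e.symm))
  have e1 : ∀ᶠ t in 𝓝[≠] (0 : ℝ), ∀ i j, i ≠ j → (w t i).1 ≠ (w t j).1 := by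
    simp only [eventually_all]
    intro i j hij
    filter_upwards [ev_quad ((z j).1 - (z i).1) ((j : ℕ) - (i : ℕ)) 0 (Or.inl (castne i j hij))]
      with t ht e
    apply ht
    simp only [w] at e
    linarith
  have e2 : ∀ᶠ t in 𝓝[≠] (0 : ℝ), ∀ i j k, i ≠ j → i ≠ k → j ≠ k →
      dt (w t i) (w t j) (w t k) ≠ 0 := by
    simp only [eventually_all]
    intro i j k hij hik hjk
    filter_upwards [ev_quad (dt (z i) (z j) (z k))
      (((z j).1 - (z i).1) * (((k : ℕ) : ℝ) ^ 2 - ((i : ℕ) : ℝ) ^ 2)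
        + (((j : ℕ) : ℝ) - ((i : ℕ) : ℝ)) * ((z k).2 - (z i).2)
        - ((z k).1 - (z i).1) * (((j : ℕ) : ℝ) ^ 2 - ((i : ℕ) : ℝ) ^ 2)
        - (((k : ℕ) : ℝ) - ((i : ℕ) : ℝ)) * ((z j).2 - (z i).2))
      ((((j : ℕ) : ℝ) - (i : ℕ)) * (((k : ℕ) : ℝ) - (i : ℕ)) * (((k : ℕ) : ℝ) - (j : ℕ)))
      (Or.inr (mul_ne_zero (mul_ne_zero (castne i j hij) (castne i k hik)) (castne j k hjk)))]
      with t ht e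
    apply ht
    rw [← e]
    simp only [w, dt]
    ring
  have w0 : ∀ i, w 0 i = z i := by intro i; simp [w]
  have cdt : ∀ i j k, Continuous (fun t => dt (w t i) (w t j) (w t k)) := by
    intro i j k
    simp only [w, dt]
    fun_prop
  have e3 : ∀ᶠ t in 𝓝 (0 : ℝ), ∀ i j, (z i).1 < (z j).1 → (w t i).1 < (w t j).1 := by
    simp only [eventually_all]
    intro i j hij
    have c1 : ContinuousAt (fun t => (w t i).1) 0 := by simp only [w]; fun_prop
    have c2 : ContinuousAt (fun t => (w t j).1) 0 := by simp only [w]; fun_prop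
    exact c1.eventually_lt c2 (by simpa only [w0] using hij)
  have e4 : ∀ᶠ t in 𝓝 (0 : ℝ), ∀ i j k, 0 < dt (z i) (z j) (z k) →
      0 < dt (w t i) (w t j) (w t k) := by
    simp only [eventually_all]
    intro i j k h
    exact (cdt i j k).continuousAt.eventually_const_lt (by simpa only [w0] using h)
  have e5 : ∀ᶠ t in 𝓝 (0 : ℝ), ∀ i j k, dt (z i) (z j) (z k) < 0 →
      dt (w t i) (w t j) (w t k) < 0 := by
    simp only [eventually_all]
    intro i j k h
    exact (cdt i j k).continuousAt.eventually_lt_const (by simpa only [w0] using h)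
  obtain ⟨t, ⟨h1, h2⟩, h3, h4, h5⟩ := ((e1.and e2).and
    ((e3.and (e4.and e5)).filter_mono nhdsWithin_le_nhds)).exists
  refine ⟨w t, ?_, h2, h3, h4, h5⟩
  intro i j e
  by_contra hij
  exact h1 i j hij (by rw [e])

lemma dt_eq_zero_of_collinear {a b c : Pt} (h : Collinear ℝ ({a, b, c} : Set Pt)) :
    dt a b c = 0 := by
  rw [collinear_iff_of_mem (p₀ := a) (by simp)] at h
  obtain ⟨v, hv⟩ := h
  obtain ⟨r, hr⟩ := hv b (by simp)
  obtain ⟨s, hs⟩ := hv c (by simp)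
  rw [hr, hs]
  simp [dt]
  ring

lemma genPos_image {n : ℕ} (w : Fin n → Pt)
    (h : ∀ i j k, i ≠ j → i ≠ k → j ≠ k → dt (w i) (w j) (w k) ≠ 0) :
    GenPos (Finset.univ.image w) := by
  intro a ha b hb c hc hab hac hbc hcol
  simp only [Finset.mem_image, Finset.mem_univ, true_and] at ha hb hc
  obtain ⟨i, rfl⟩ := ha
  obtain ⟨j, rfl⟩ := hb
  obtain ⟨k, rfl⟩ := hc
  exact h i j k (fun e => hab (by rw [e])) (fun e => hac (by rw [e])) (fun e => hbc (by rw [e]))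
    (dt_eq_zero_of_collinear hcol)

lemma card_le_two_pow {S : Finset (Set Pt)} {Q : Finset Pt} (h : SepPts S Q) :
    Q.card ≤ 2 ^ S.card := by
  classical
  rw [← Finset.card_powerset]
  apply Finset.card_le_card_of_injOn (fun x => S.filter (fun A => x ∈ A))
  · intro x _
    simp only [Finset.coe_powerset, Set.mem_preimage, Set.mem_powerset_iff, Finset.coe_subset]
    exact Finset.filter_subset _ _
  · intro x hx y hy hxy
    by_contra hne
    obtain ⟨A, hA, hiff⟩ := h x hx y hy hne
    have : A ∈ S.filter (fun A => x ∈ A) ↔ A ∈ S.filter (fun A => y ∈ A) := by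
      have hxy : S.filter (fun A => x ∈ A) = S.filter (fun A => y ∈ A) := hxy
      rw [hxy]
    simp only [Finset.mem_filter, hA, true_and] at this
    tauto

/-- Counting step. -/
lemma counting {n s t : ℕ} {P : Finset Pt} (hP : Good s t P) (hst : 1 ≤ s + t)
    (z w : Fin n → Pt)
    (h3 : ∀ i j, (z i).1 < (z j).1 → (w i).1 < (w j).1)
    (h4 : ∀ i j k, 0 < dt (z i) (z j) (z k) → 0 < dt (w i) (w j) (w k))
    (h5 : ∀ i j k, dt (z i) (z j) (z k) < 0 → dt (w i) (w j) (w k) < 0)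
    (hinj : Function.Injective w)
    (hfib : ∀ p ∈ P, ∃ i j k, i ≠ j ∧ i ≠ k ∧ j ≠ k ∧ z i = p ∧ z j = p ∧ z k = p)
    (S : Finset (Set Pt)) (hS : ∀ A ∈ S, Convex ℝ A) (hsep : SepPts S (Finset.univ.image w)) :
    P.card * 2 ≤ S.card * (s + t) := by
  classical
  let cut : Pt → Set Pt → Prop := fun p A => ∃ i j, z i = p ∧ z j = p ∧ w i ∈ A ∧ w j ∉ A
  have hsep' : ∀ i j, i ≠ j → ∃ A ∈ S, (w i ∈ A ↔ w j ∉ A) := fun i j hij =>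
    hsep (w i) (by simp) (w j) (by simp) (fun e => hij (hinj e))
  have mkcut : ∀ p A i j, z i = p → z j = p → (w i ∈ A ↔ w j ∉ A) → cut p A := by
    intro p A i j hi hj hiff
    by_cases hA : w i ∈ A
    · exact ⟨i, j, hi, hj, hA, hiff.1 hA⟩
    · exact ⟨j, i, hj, hi, by tauto, hA⟩
  apply Finset.card_mul_le_card_mul cut
  · intro p hp
    obtain ⟨i, j, k, hij, hik, hjk, hi, hj, hk⟩ := hfib p hp
    obtain ⟨A, hA, hAc⟩ := hsep' i j hij
    have : ∃ B ∈ S, cut p B ∧ A ≠ B := by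
      by_cases hik' : (w i ∈ A ↔ w k ∈ A)
      · obtain ⟨B, hB, hBc⟩ := hsep' i k hik
        refine ⟨B, hB, mkcut p B i k hi hk hBc, ?_⟩
        rintro rfl
        tauto
      · obtain ⟨B, hB, hBc⟩ := hsep' j k hjk
        refine ⟨B, hB, mkcut p B j k hj hk hBc, ?_⟩
        rintro rfl
        tauto
    obtain ⟨B, hB, hBc, hne⟩ := this
    rw [← Finset.card_pair hne]
    apply Finset.card_le_card
    intro X hX
    rw [Finset.mem_insert, Finset.mem_singleton] at hX
    rw [Finset.mem_bipartiteAbove]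
    rcases hX with rfl | rfl
    · exact ⟨hA, mkcut p _ i j hi hj hAc⟩
    · exact ⟨hB, hBc⟩
  · intro A hA
    by_contra hlt
    have hsub : Finset.bipartiteBelow cut P A ⊆ P := Finset.filter_subset _ _
    obtain ⟨l, hl, r, hr, p, hp, p', hp', q, hq, i1, i2, i3, i4, i5, i6⟩ :=
      (hP.mono hsub).exists_inner hst (not_le.1 hlt)
    have hc : ∀ x ∈ Finset.bipartiteBelow cut P A, cut x A := fun x hx =>
      (Finset.mem_bipartiteBelow cut |>.1 hx).2
    obtain ⟨l, -, rfl, -, hlA, -⟩ := hc l hl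
    obtain ⟨r, -, rfl, -, hrA, -⟩ := hc r hr
    obtain ⟨p, -, rfl, -, hpA, -⟩ := hc p hp
    obtain ⟨p', -, rfl, -, hpA', -⟩ := hc p' hp'
    obtain ⟨-, q, -, rfl, -, hqA⟩ := hc q hq
    exact hqA (mem_of_chords (hS A hA) hlA hrA hpA hpA' (h3 _ _ i1) (h3 _ _ i2) (h3 _ _ i3)
      (h3 _ _ i4) (h5 _ _ _ i5) (h4 _ _ _ i6))

lemma choose_growth (K : ℕ) (hK : 6 ≤ K) :
    7 * K.choose (K / 2) ≤ 4 * (K + 1).choose ((K + 1) / 2) := by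
  obtain ⟨m, rfl | rfl⟩ := Nat.even_or_odd' K
  · have e1 : 2 * m / 2 = m := by omega
    have e2 : (2 * m + 1) / 2 = m := by omega
    rw [e1, e2]
    have h := Nat.add_one_mul_choose_eq (2 * m) m
    have h' := Nat.choose_symm_half m
    rw [h'] at h
    have hm : 3 ≤ m := by omega
    have : (m + 1) * (7 * (2 * m).choose m) ≤ (m + 1) * (4 * (2 * m + 1).choose m) := by
      nlinarith [Nat.zero_le ((2 * m).choose m)]
    exact Nat.le_of_mul_le_mul_left this (by omega)
  · have e1 : (2 * m + 1) / 2 = m := by omega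
    have e2 : (2 * m + 1 + 1) / 2 = m + 1 := by omega
    rw [e1, e2, Nat.choose_succ_succ, Nat.succ_eq_add_one, Nat.choose_symm_half]
    omega

lemma pow_le_choose (K : ℕ) (hK : 6 ≤ K) : 2 ^ (7 * (K + 1)) ≤ (3 * K.choose (K / 2)) ^ 9 := by
  induction K, hK using Nat.le_induction with
  | base => norm_num [Nat.choose]
  | succ K hK ih =>
    have h := choose_growth K hK
    have h9 : (7 * (3 * K.choose (K / 2))) ^ 9 ≤ (4 * (3 * (K + 1).choose ((K + 1) / 2))) ^ 9 :=
      Nat.pow_le_pow_left (by omega) 9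
    rw [mul_pow, mul_pow 4] at h9
    have e : 2 ^ (7 * (K + 1 + 1)) = 2 ^ 7 * 2 ^ (7 * (K + 1)) := by
      rw [← pow_add]; congr 1; ring
    rw [e]
    norm_num at h9 ⊢
    omega

lemma exists_K (n : ℕ) (hn : 60 ≤ n) : ∃ K, 6 ≤ K ∧ n / 3 ≤ K.choose (K / 2) ∧
    2 ^ (7 * K) ≤ n ^ 9 := by
  classical
  by_cases h20 : n / 3 ≤ 20
  · refine ⟨6, le_rfl, by simpa [Nat.choose] using h20, ?_⟩
    calc 2 ^ (7 * 6) ≤ 60 ^ 9 := by norm_num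
      _ ≤ n ^ 9 := Nat.pow_le_pow_left hn 9
  · have hex : ∃ K, n / 3 ≤ (K + 6).choose ((K + 6) / 2) := by
      have grow : ∀ K, K ≤ (K + 6).choose ((K + 6) / 2) := by
        intro K
        have := Nat.choose_le_middle 1 (K + 6)
        simp at this
        simpa using le_trans (by omega) this
      exact ⟨n / 3, grow _⟩
    have hs := Nat.find_spec hex
    have hm := fun m => @Nat.find_min _ _ hex m
    set K := Nat.find hex
    have hK0 : K ≠ 0 := by
      intro e
      rw [e] at hs
      norm_num [Nat.choose] at hs
      omega
    refine ⟨K + 6, by omega, hs, ?_⟩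
    have h1 := hm (K - 1) (by omega)
    have e : K - 1 + 6 = K + 5 := by omega
    rw [e] at h1
    have h2 := pow_le_choose (K + 5) (by omega)
    have e' : K + 5 + 1 = K + 6 := by omega
    rw [e'] at h2
    exact h2.trans (Nat.pow_le_pow_left (by omega) 9)

lemma logb_lower {n a b : ℕ} (h : 2 ^ a ≤ n ^ b) :
    (a : ℝ) ≤ b * Real.logb 2 n := by
  have h' : (2 : ℝ) ^ a ≤ (n : ℝ) ^ b := by exact_mod_cast h
  have := Real.logb_le_logb_of_le (b := 2) (by norm_num) (by positivity) h'
  rwa [Real.logb_pow, Real.logb_pow, Real.logb_self_eq_one (by norm_num), mul_one] at this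

lemma small_case {n s : ℕ} (hn : 2 ≤ n) (hn' : n < 60) (h : n ≤ 2 ^ s) :
    (n : ℝ) / (2 * Real.logb 2 n) ≤ s := by
  have key : ∀ j a : ℕ, j ≤ s → 1 ≤ a → 2 ^ a ≤ n ^ 2 → n ≤ j * a →
      (n : ℝ) / (2 * Real.logb 2 n) ≤ s := by
    intro j a hj ha h1 h2
    have h3 := logb_lower h1
    have ha' : (1 : ℝ) ≤ a := by exact_mod_cast ha
    push_cast at h3
    rw [div_le_iff₀ (by linarith)]
    have h2' : (n : ℝ) ≤ j * a := by exact_mod_cast h2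
    have hj' : (j : ℝ) ≤ s := by exact_mod_cast hj
    calc (n : ℝ) ≤ j * a := h2'
      _ ≤ s * (2 * Real.logb 2 n) := by gcongr
  have lt : ∀ j, 2 ^ j < n → j + 1 ≤ s := by
    intro j hj
    by_contra hc
    have := Nat.pow_le_pow_right (n := 2) (by norm_num) (show s ≤ j by omega)
    omega
  rcases le_or_gt n 2 with c | c
  · exact key 1 2 (lt 0 (by norm_num; omega)) (by norm_num) (by nlinarith) (by omega)
  rcases le_or_gt n 4 with c | c
  · exact key 2 3 (lt 1 (by norm_num; omega)) (by norm_num) (by nlinarith) (by omega)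
  rcases le_or_gt n 8 with c | c
  · exact key 3 4 (lt 2 (by norm_num; omega)) (by norm_num) (by nlinarith) (by omega)
  rcases le_or_gt n 16 with c | c
  · exact key 4 6 (lt 3 (by norm_num; omega)) (by norm_num) (by nlinarith) (by omega)
  rcases le_or_gt n 32 with c | c
  · exact key 5 8 (lt 4 (by norm_num; omega)) (by norm_num) (by nlinarith) (by omega)
  · exact key 6 10 (lt 5 (by norm_num; omega)) (by norm_num) (by nlinarith) (by omega)

lemma large_case {n s K : ℕ} (hn : 60 ≤ n) (h1 : 2 ^ (7 * K) ≤ n ^ 9) (hK : 6 ≤ K)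
    (h : n / 3 * 2 ≤ s * K) : (n : ℝ) / (2 * Real.logb 2 n) ≤ s := by
  have h3 := logb_lower h1
  push_cast at h3
  have hK' : (6 : ℝ) ≤ K := by exact_mod_cast hK
  rw [div_le_iff₀ (by linarith)]
  have h4 : 7 * n ≤ 14 * (s * K) := by omega
  have h4' : (9 : ℝ) * n ≤ 14 * (s * K) := by
    have : 9 * n ≤ 14 * (s * K) := by omega
    exact_mod_cast this
  have hs : (0 : ℝ) ≤ s := by positivity
  nlinarith [mul_le_mul_of_nonneg_left h3 hs]

end CGP

/-- There is an `n`-point set in general position (a set of twin pairs over an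
Erdős–Szekeres-type construction) every separating family of convex sets of
which has at least `n / (2 log₂ n)` members; hence `s'(n, 𝒜) ≥ n / (2 log n)`. -/
theorem convex_general_position_lower_bound (n : ℕ) (hn : 2 ≤ n) :
    ∃ Q : Finset Pt, Q.card = n ∧ GenPos Q ∧
      ∀ S : Finset (Set Pt), (∀ A ∈ S, Convex ℝ A) → SepPts S Q →
        (n : ℝ) / (2 * Real.logb 2 n) ≤ S.card := by
  open CGP in
  rcases lt_or_ge n 60 with h60 | h60
  · obtain ⟨w, hinj, hgen, -⟩ := exists_perturb (fun _ : Fin n => (0 : Pt))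
    have hcard : (Finset.univ.image w).card = n := by
      rw [Finset.card_image_of_injective _ hinj, Finset.card_fin]
    refine ⟨Finset.univ.image w, hcard, genPos_image w hgen, ?_⟩
    intro S _ hsep
    have := card_le_two_pow hsep
    rw [hcard] at this
    exact small_case hn h60 this
  · obtain ⟨K, hK, hc, hpow⟩ := exists_K n h60
    obtain ⟨P0, hP0c, hP0⟩ := exists_good (K / 2) (K - K / 2)
    have eK : K / 2 + (K - K / 2) = K := by omega
    rw [eK] at hP0c
    rw [← hP0c] at hc
    obtain ⟨P, hsub, hPc⟩ := Finset.exists_subset_card_eq hc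
    have hP := hP0.mono hsub
    have hpos : 0 < n / 3 := by omega
    let e : Fin (n / 3) ≃ P := (Finset.equivFinOfCardEq hPc).symm
    let z : Fin n → Pt := fun i => (e ⟨i % (n / 3), Nat.mod_lt _ hpos⟩ : Pt)
    obtain ⟨w, hinj, hgen, h3, h4, h5⟩ := exists_perturb z
    have hcard : (Finset.univ.image w).card = n := by
      rw [Finset.card_image_of_injective _ hinj, Finset.card_fin]
    refine ⟨Finset.univ.image w, hcard, genPos_image w hgen, ?_⟩
    intro S hS hsep
    have hcount := counting hP (by omega) z w h3 h4 h5 hinj (by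
      intro p hp
      obtain ⟨a, ha⟩ := e.surjective ⟨p, hp⟩
      have ha3 := a.2
      have hz : ∀ (m : ℕ) (hm : a.1 + n / 3 * m < n), z ⟨a.1 + n / 3 * m, hm⟩ = p := by
        intro m hm
        simp only [z, Nat.add_mul_mod_self_left, Nat.mod_eq_of_lt ha3]
        rw [show (⟨a.1, _⟩ : Fin (n / 3)) = a from rfl, ha]
      refine ⟨⟨a.1 + n / 3 * 0, by omega⟩, ⟨a.1 + n / 3 * 1, by omega⟩,
        ⟨a.1 + n / 3 * 2, by omega⟩, ?_, ?_, ?_, hz _ _, hz _ _, hz _ _⟩ <;>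
      · rw [Ne, Fin.mk.injEq]
        omega) S hS hsep
    rw [hPc, eK] at hcount
    exact large_case h60 hpow hK hcount
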